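/- Let g ∈ G(A,L) be represented by a semi-reduced word ∏_{i=1}^k t^{α_i} x^{v_i} t^{-α_i} (with α_i ∈ ℤ, v_i ∈ ℤ^n), and let v ∈ ℤ^n. Then g commutes with x^v if and only if v ∈ ⋂_{j=γ_-+1}^{γ_+} A^j L, where γ_- = min{0, α_1, …, α_k} and γ_+ = max{0, α_1, …, α_k}. -/

import Mathlib

open Matrix

noncomputable section

/-- The coercion `ℤ^n → ℚ^n` as an additive homomorphism. -/
def ZtoQ (n : ℕ) : (Fin n → ℤ) →+ (Fin n → ℚ) :=
  AddMonoidHom.mk' (fun v i => (v i : ℚ)) (by intro a b; funext i; simp)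

/-- The image `A·L ⊆ ℚ^n` of a subgroup `L ≤ ℤ^n` under the matrix `A`. -/
def QImage {n : ℕ} (A : Matrix (Fin n) (Fin n) ℚ) (L : AddSubgroup (Fin n → ℤ)) :
    AddSubgroup (Fin n → ℚ) :=
  (L.map (ZtoQ n)).map A.mulVecLin.toAddMonoidHom

/-- The subgroup `AL` of `ℤ^n`, i.e. the set of integer vectors lying in `A·L`. -/
def ALsub {n : ℕ} (A : Matrix (Fin n) (Fin n) ℚ) (L : AddSubgroup (Fin n → ℤ)) :
    AddSubgroup (Fin n → ℤ) :=
  (QImage A L).comap (ZtoQ n)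

/-- `x^v = x_1^{v_1} ⋯ x_n^{v_n}` in the free group on `x_1,…,x_n,t`. -/
def xWord (n : ℕ) (v : Fin n → ℤ) : FreeGroup (Fin n ⊕ Unit) :=
  (List.ofFn fun i => (FreeGroup.of (Sum.inl i) : FreeGroup (Fin n ⊕ Unit)) ^ (v i)).prod

/-- The relations of the Leary–Minasyan group `G(A,L)`. -/
def LMrels (n : ℕ) (A : Matrix (Fin n) (Fin n) ℚ) (L : AddSubgroup (Fin n → ℤ)) :
    Set (FreeGroup (Fin n ⊕ Unit)) :=
  {r | (∃ i j : Fin n,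
          r = FreeGroup.of (Sum.inl i) * FreeGroup.of (Sum.inl j) *
              (FreeGroup.of (Sum.inl i))⁻¹ * (FreeGroup.of (Sum.inl j))⁻¹) ∨
       (∃ v ∈ L, ∃ w : Fin n → ℤ, ZtoQ n w = A.mulVec (ZtoQ n v) ∧
          r = FreeGroup.of (Sum.inr ()) * xWord n v * (FreeGroup.of (Sum.inr ()))⁻¹ *
              (xWord n w)⁻¹)}

/-- The Leary–Minasyan group `G(A,L)`. -/
abbrev LM (n : ℕ) (A : Matrix (Fin n) (Fin n) ℚ) (L : AddSubgroup (Fin n → ℤ)) :=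
  PresentedGroup (LMrels n A L)

/-- The generator `x_i` of `G(A,L)`. -/
def Xg (n : ℕ) (A : Matrix (Fin n) (Fin n) ℚ) (L : AddSubgroup (Fin n → ℤ)) (i : Fin n) :
    LM n A L :=
  PresentedGroup.of (Sum.inl i)

/-- The stable letter `t` of `G(A,L)`. -/
def Tg (n : ℕ) (A : Matrix (Fin n) (Fin n) ℚ) (L : AddSubgroup (Fin n → ℤ)) : LM n A L :=
  PresentedGroup.of (Sum.inr ())

/-- The element `x^v` of `G(A,L)`. -/
def Xv (n : ℕ) (A : Matrix (Fin n) (Fin n) ℚ) (L : AddSubgroup (Fin n → ℤ)) (v : Fin n → ℤ) :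
    LM n A L :=
  (List.ofFn fun i => (Xg n A L i) ^ (v i)).prod

/-- The base subgroup `H = ⟨x_1,…,x_n⟩` of `G(A,L)`. -/
def Hsub (n : ℕ) (A : Matrix (Fin n) (Fin n) ℚ) (L : AddSubgroup (Fin n → ℤ)) :
    Subgroup (LM n A L) :=
  Subgroup.closure (Set.range (Xg n A L))

/-- The set `⋃_{j∈ℤ} A^j(ℤ^n) ⊆ ℚ^n`. -/
def unionSet {n : ℕ} (A : Matrix (Fin n) (Fin n) ℚ) : Set (Fin n → ℚ) :=
  ⋃ j : ℤ, (A ^ j).mulVec '' Set.range (ZtoQ n)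

/-- Cast an integer matrix to a rational matrix. -/
def QMat {k : ℕ} (M : Matrix (Fin k) (Fin k) ℤ) : Matrix (Fin k) (Fin k) ℚ :=
  M.map (Int.cast)

/-- The block matrix `[[1, 0ᵀ],[u, C]]`. -/
def blockOne {k : ℕ} (u : Fin k → ℤ) (C : Matrix (Fin k) (Fin k) ℤ) :
    Matrix (Fin (k+1)) (Fin (k+1)) ℤ :=
  Matrix.of fun i j =>
    Fin.cases (Fin.cases 1 (fun _ => 0) j) (fun i' => Fin.cases (u i') (fun j' => C i' j') j) i

/-- Transport a subgroup of `ℤ^a` along an equality `a = b` of dimensions. -/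
def reindexSub {a b : ℕ} (h : a = b) (L : AddSubgroup (Fin a → ℤ)) :
    AddSubgroup (Fin b → ℤ) :=
  L.map (AddMonoidHom.mk' (fun v => v ∘ (finCongr h).symm) (fun _ _ => rfl))


/-- The sequence of `t`-exponents `β_1 = α_1, β_i = α_i - α_{i-1}, β_{k+1} = -α_k`
(0-indexed) of the word `t^{α_1} x^{v_1} t^{α_2-α_1} ⋯ x^{v_k} t^{-α_k}`. -/
def betaSeq (k : ℕ) (α : ℕ → ℤ) (i : ℕ) : ℤ :=
  if i = 0 then α 0 else if i = k then -(α (k - 1)) else α i - α (i - 1)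

/-- The membership `w ∈ A^j L`, for an integer vector `w`. -/
def MemZpowImage {n : ℕ} (A : Matrix (Fin n) (Fin n) ℚ) (L : AddSubgroup (Fin n → ℤ)) (j : ℤ)
    (w : Fin n → ℤ) : Prop :=
  ∃ u ∈ L, (A ^ j).mulVec (ZtoQ n u) = ZtoQ n w

lemma ZtoQ_injective (n : ℕ) : Function.Injective (ZtoQ n) := by
  intro a b h
  funext i
  have := congrFun h i
  simpa [ZtoQ] using this

lemma mem_QImage {n : ℕ} {A : Matrix (Fin n) (Fin n) ℚ} {L : AddSubgroup (Fin n → ℤ)}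
    {q : Fin n → ℚ} : q ∈ QImage A L ↔ ∃ a ∈ L, A.mulVec (ZtoQ n a) = q := by
  simp [QImage, AddSubgroup.mem_map]

lemma mem_ALsub {n : ℕ} {A : Matrix (Fin n) (Fin n) ℚ} {L : AddSubgroup (Fin n → ℤ)}
    {b : Fin n → ℤ} : b ∈ ALsub A L ↔ ∃ a ∈ L, A.mulVec (ZtoQ n a) = ZtoQ n b := by
  simp [ALsub, mem_QImage]

namespace HNNExtension

variable {G : Type*} [CommGroup G] {A B : Subgroup G} (φ : A ≃* B)

/-- The element `∏ t ^ u * g` of the HNN extension determined by a list of pairs `(u, g)`. -/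
def syllableProd (l : List (ℤˣ × G)) : HNNExtension G A B φ :=
  (l.map fun x => t ^ (x.1 : ℤ) * of x.2).prod

lemma of_mul_t_zpow_unit (u : ℤˣ) (a : toSubgroup A B u) :
    (of (toSubgroupEquiv φ u a : G) : HNNExtension G A B φ) * t ^ (u : ℤ) =
      t ^ (u : ℤ) * of (a : G) := by
  rcases Int.units_eq_one_or u with rfl | rfl
  · rw [Units.val_one, zpow_one]
    exact (t_mul_of (φ := φ) a).symm
  · rw [Units.val_neg, Units.val_one, _root_.zpow_neg_one]
    exact (inv_t_mul_of (φ := φ) a).symm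

variable {φ} in
/-- A consequence of Britton's lemma: if a reduced word carries `w` to an element of the base
group, then so does its first syllable. -/
lemma exists_of_mul_syllableProd_cons {u : ℤˣ} {g : G} {l : List (ℤˣ × G)}
    (hl : ((u, g) :: l).IsChain fun a b => a.2 ∈ toSubgroup A B a.1 → a.1 = b.1) {w w' : G}
    (h : of w * syllableProd φ ((u, g) :: l) = syllableProd φ ((u, g) :: l) * of w') :
    ∃ a : toSubgroup A B u, (toSubgroupEquiv φ u a : G) = w ∧
      of (a : G) * syllableProd φ l = syllableProd φ l * of w' := by
  have hw : w ∈ toSubgroup A B (-u) := by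
    obtain ⟨l₀, ⟨u₀, g₀⟩, hl₀⟩ := (List.eq_nil_or_concat ((u, g) :: l)).resolve_left (by simp)
    rw [List.concat_eq_append] at hl₀
    have hhead : u ∈ (l₀ ++ [(u₀, g₀)]).head?.map Prod.fst := by simp [← hl₀]
    rw [hl₀] at hl h
    have hl' : (l₀ ++ [(u₀, g₀ * w')]).IsChain
        fun a b => a.2 ∈ toSubgroup A B a.1 → a.1 = b.1 := by
      rw [List.isChain_append] at hl ⊢
      refine ⟨hl.1, .singleton _, ?_⟩
      simpa using hl.2.2
    let W₁ : NormalWord.ReducedWord G A B := ⟨w, _, hl⟩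
    let W₂ : NormalWord.ReducedWord G A B := ⟨1, _, hl'⟩
    have key := (ReducedWord.map_fst_eq_and_of_prod_eq φ (w₁ := W₁) (w₂ := W₂) (by
      simp only [NormalWord.ReducedWord.prod, W₁, W₂]
      simpa [syllableProd, mul_assoc] using h)).2 u hhead
    simpa [W₁, W₂] using key
  obtain ⟨a, ha⟩ := (toSubgroupEquiv φ u).surjective ⟨w, hw⟩
  have haw : (toSubgroupEquiv φ u a : G) = w := by rw [ha]
  refine ⟨a, haw, ?_⟩
  have hcons : syllableProd φ ((u, g) :: l) = t ^ (u : ℤ) * (of g * syllableProd φ l) := by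
    simp [syllableProd, mul_assoc]
  rw [hcons, ← mul_assoc, ← haw, of_mul_t_zpow_unit, mul_assoc, mul_assoc, mul_right_inj,
    ← mul_assoc, ← map_mul, mul_comm (a : G), map_mul, mul_assoc, mul_assoc, mul_right_inj] at h
  exact h

/-- The list of syllables spelling `t ^ m * g` for `m ≠ 0`; empty for `m = 0`. -/
def powerSyllables : ℤ → G → List (ℤˣ × G)
  | .ofNat 0, _ => []
  | .ofNat (m + 1), g => List.replicate m (1, 1) ++ [(1, g)]
  | .negSucc m, g => List.replicate m (-1, 1) ++ [(-1, g)]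

lemma sum_powerSyllables (m : ℤ) (g : G) :
    ((powerSyllables m g).map fun x => (x.1 : ℤ)).sum = m := by
  match m with
  | .ofNat 0 => rfl
  | .ofNat (m + 1) => simp [powerSyllables]
  | .negSucc m => simp [powerSyllables, Int.negSucc_eq]; ring

lemma syllableProd_powerSyllables {m : ℤ} {g : G} (h : m = 0 → g = 1) :
    syllableProd φ (powerSyllables m g) = t ^ m * of g := by
  match m with
  | .ofNat 0 => simp [powerSyllables, syllableProd, h rfl]
  | .ofNat (m + 1) =>
    simp only [powerSyllables, syllableProd, List.map_append, List.map_replicate,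
      List.prod_append, List.prod_replicate]
    rw [Int.ofNat_eq_natCast, zpow_natCast]
    simp [← mul_assoc, ← pow_succ]
  | .negSucc m =>
    simp only [powerSyllables, syllableProd, List.map_append, List.map_replicate,
      List.prod_append, List.prod_replicate]
    simp [← mul_assoc, pow_succ']

/-- The list of syllables of the word `∏ t ^ m * g` given by a list of pairs `(m, g)`. -/
def syllables (p : List (ℤ × G)) : List (ℤˣ × G) :=
  p.flatMap fun x => powerSyllables x.1 x.2

lemma syllables_cons (x : ℤ × G) (p : List (ℤ × G)) :
    syllables (x :: p) = powerSyllables x.1 x.2 ++ syllables p := rfl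

lemma sum_syllables (p : List (ℤ × G)) :
    ((syllables p).map fun x => (x.1 : ℤ)).sum = (p.map Prod.fst).sum := by
  induction p with
  | nil => rfl
  | cons x p ih => simp [syllables_cons, ih, sum_powerSyllables]

lemma syllableProd_syllables {p : List (ℤ × G)} (h : ∀ x ∈ p, x.1 = 0 → x.2 = 1) :
    syllableProd φ (syllables p) = (p.map fun x => t ^ x.1 * of x.2).prod := by
  induction p with
  | nil => rfl
  | cons x p ih =>
    have hx := syllableProd_powerSyllables φ (h x (by simp))
    have ih := ih fun y hy => h y (by simp [hy])
    simp only [syllableProd] at hx ih ⊢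
    rw [syllables_cons, List.map_append, List.prod_append, hx, ih, List.map_cons, List.prod_cons]

lemma isPrefix_syllables {p q : List (ℤ × G)} (h : p <+: q) : syllables p <+: syllables q := by
  obtain ⟨r, rfl⟩ := h
  exact ⟨syllables r, by simp [syllables]⟩

variable (A B) in
/-- The condition for `t ^ x.1 * x.2 * t ^ y.1` to contain no reducible subword. -/
def ReducedAt (x y : ℤ × G) : Prop :=
  x.1 ≠ 0 ∧ (0 < x.1 → y.1 < 0 → x.2 ∉ A) ∧ (x.1 < 0 → 0 < y.1 → x.2 ∉ B)

lemma powerSyllables_cases (m : ℤ) (g : G) :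
    (m = 0 ∧ powerSyllables m g = []) ∨ (0 < m ∧ ∃ k, powerSyllables m g =
      List.replicate k (1, 1) ++ [(1, g)]) ∨ (m < 0 ∧ ∃ k, powerSyllables m g =
      List.replicate k (-1, 1) ++ [(-1, g)]) := by
  match m with
  | .ofNat 0 => exact .inl ⟨rfl, rfl⟩
  | .ofNat (m + 1) => exact .inr (.inl ⟨by simp, m, rfl⟩)
  | .negSucc m => exact .inr (.inr ⟨Int.negSucc_lt_zero m, m, rfl⟩)

lemma isChain_replicate_append (u : ℤˣ) (g : G) (k : ℕ) :
    (List.replicate k (u, 1) ++ [(u, g)] : List (ℤˣ × G)).IsChain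
      fun a b => a.2 ∈ toSubgroup A B a.1 → a.1 = b.1 := by
  refine List.Pairwise.isChain (R := fun a b : ℤˣ × G => a.2 ∈ toSubgroup A B a.1 → a.1 = b.1) ?_
  simp [List.pairwise_append, List.pairwise_replicate]

lemma isChain_powerSyllables (m : ℤ) (g : G) :
    (powerSyllables m g).IsChain fun a b => a.2 ∈ toSubgroup A B a.1 → a.1 = b.1 := by
  rcases powerSyllables_cases m g with ⟨-, h⟩ | ⟨-, k, h⟩ | ⟨-, k, h⟩ <;> rw [h]
  · exact .nil
  all_goals exact isChain_replicate_append _ _ _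

lemma head?_replicate_append (u : ℤˣ) (g : G) (k : ℕ) (l : List (ℤˣ × G)) :
    ((List.replicate k (u, 1) ++ [(u, g)]) ++ l).head?.map Prod.fst = some u := by
  cases k <;> simp [List.replicate_succ]

lemma isChain_syllables {p : List (ℤ × G)} (h : p.IsChain (ReducedAt A B)) :
    (syllables p).IsChain fun a b => a.2 ∈ toSubgroup A B a.1 → a.1 = b.1 := by
  induction p with
  | nil => exact .nil
  | cons x p ih =>
    rw [List.isChain_cons] at h
    rw [syllables_cons, List.isChain_append]
    refine ⟨isChain_powerSyllables _ _, ih h.2, ?_⟩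
    intro a ha b hb hab
    cases p with
    | nil => simp [syllables] at hb
    | cons y p =>
      obtain ⟨h0, hpos, hneg⟩ := h.1 y (by simp)
      have hb' : b.1 ∈ (syllables (y :: p)).head?.map Prod.fst := by
        rw [Option.mem_def] at hb ⊢
        rw [hb]; rfl
      have hy : p = [] ∨ y.1 ≠ 0 := by
        cases p with
        | nil => simp
        | cons z p => exact .inr ((List.isChain_cons.1 h.2).1 z (by simp)).1
      have hbs : (b.1 = 1 ∧ 0 < y.1) ∨ (b.1 = -1 ∧ y.1 < 0) := by
        rw [syllables_cons] at hb'
        rcases powerSyllables_cases y.1 y.2 with ⟨hy0, e⟩ | ⟨hy0, k, e⟩ | ⟨hy0, k, e⟩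
        · rcases hy with rfl | hy
          · rw [e] at hb'
            simp [syllables] at hb'
          · exact absurd hy0 hy
        all_goals
          rw [e, head?_replicate_append] at hb'
          simp_all
      rcases powerSyllables_cases x.1 x.2 with ⟨hx0, h⟩ | ⟨hx0, k, h⟩ | ⟨hx0, k, h⟩
      · exact absurd hx0 h0
      all_goals
        rw [h] at ha
        simp only [List.getLast?_append, List.getLast?_singleton, Option.some_or,
          Option.mem_def, Option.some.injEq] at ha
        subst ha
        rcases hbs with ⟨hb1, hy0⟩ | ⟨hb1, hy0⟩ <;> simp_all

end HNNExtension

section LearyMinasyan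

variable {n : ℕ} {A : Matrix (Fin n) (Fin n) ℚ} {L : AddSubgroup (Fin n → ℤ)}

lemma memZpowImage_zero {w : Fin n → ℤ} : MemZpowImage A L 0 w ↔ w ∈ L := by
  simp [MemZpowImage, (ZtoQ_injective n).eq_iff]

lemma memZpowImage_one {w : Fin n → ℤ} : MemZpowImage A L 1 w ↔ w ∈ ALsub A L := by
  simp [MemZpowImage, mem_ALsub]

lemma mulVec_left_injective (hA : IsUnit A.det) : Function.Injective A.mulVec :=
  Matrix.mulVec_injective_iff_isUnit.2 ((Matrix.isUnit_iff_isUnit_det A).2 hA)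

lemma memZpowImage_add_one (hA : IsUnit A.det) {w₁ w : Fin n → ℤ}
    (h : A.mulVec (ZtoQ n w₁) = ZtoQ n w) (j : ℤ) :
    MemZpowImage A L (j + 1) w ↔ MemZpowImage A L j w₁ := by
  refine exists_congr fun u => and_congr_right fun _ => ?_
  rw [← h, add_comm, Matrix.zpow_one_add hA, ← Matrix.mulVec_mulVec,
    (mulVec_left_injective hA).eq_iff]

open Multiplicative in
/-- The isomorphism `φ : L → AL` (written multiplicatively) is `v ↦ Av`. -/
def ActsByMulVec (φ : AddSubgroup.toSubgroup L ≃* AddSubgroup.toSubgroup (ALsub A L)) : Prop :=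
  ∀ a : AddSubgroup.toSubgroup L, A.mulVec (ZtoQ n (toAdd (a : Multiplicative (Fin n → ℤ)))) =
    ZtoQ n (toAdd (φ a : Multiplicative (Fin n → ℤ)))

open Multiplicative in
lemma exists_mulEquiv_toSubgroup (hA : IsUnit A.det) (hLA : QImage A L ≤ (ZtoQ n).range) :
    ∃ φ : AddSubgroup.toSubgroup L ≃* AddSubgroup.toSubgroup (ALsub A L), ActsByMulVec φ := by
  have hex : ∀ a : AddSubgroup.toSubgroup L, ∃ b : AddSubgroup.toSubgroup (ALsub A L),
      A.mulVec (ZtoQ n (toAdd (a : Multiplicative (Fin n → ℤ)))) =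
        ZtoQ n (toAdd (b : Multiplicative (Fin n → ℤ))) := by
    rintro ⟨a, ha⟩
    obtain ⟨b, hb⟩ := hLA (mem_QImage.2 ⟨toAdd a, ha, rfl⟩)
    exact ⟨⟨ofAdd b, mem_ALsub.2 ⟨toAdd a, ha, hb.symm⟩⟩, hb.symm⟩
  choose f hf using hex
  have heq {b b' : AddSubgroup.toSubgroup (ALsub A L)}
      (h : ZtoQ n (toAdd (b : Multiplicative (Fin n → ℤ))) =
        ZtoQ n (toAdd (b' : Multiplicative (Fin n → ℤ)))) : b = b' :=
    Subtype.ext (toAdd.injective (ZtoQ_injective n h))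
  let F : AddSubgroup.toSubgroup L →* AddSubgroup.toSubgroup (ALsub A L) :=
    MonoidHom.mk' f fun a b => heq (by
      rw [← hf, Subgroup.coe_mul, Subgroup.coe_mul, toAdd_mul, toAdd_mul, map_add, map_add,
        Matrix.mulVec_add, hf, hf])
  refine ⟨MulEquiv.ofBijective F ⟨fun a b hab => ?_, fun b => ?_⟩, hf⟩
  · have hab : f a = f b := hab
    exact Subtype.ext (toAdd.injective (ZtoQ_injective n (mulVec_left_injective hA
      (by rw [hf, hf, hab]))))
  · obtain ⟨a, ha, hab⟩ := mem_ALsub.1 b.2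
    exact ⟨⟨ofAdd a, ha⟩, heq ((hf _).symm.trans hab)⟩

open Multiplicative HNNExtension in
/-- If a reduced word carries `x^w` to an element of the base group, then `w ∈ A^j L` for every `j`
between `0` and the `t`-exponent of a prefix of the word. -/
lemma memZpowImage_of_isPrefix (hA : IsUnit A.det)
    {φ : AddSubgroup.toSubgroup L ≃* AddSubgroup.toSubgroup (ALsub A L)} (hφ : ActsByMulVec φ)
    {l : List (ℤˣ × Multiplicative (Fin n → ℤ))}
    (hl : l.IsChain fun a b => a.2 ∈ toSubgroup (AddSubgroup.toSubgroup L)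
      (AddSubgroup.toSubgroup (ALsub A L)) a.1 → a.1 = b.1)
    {w w' : Multiplicative (Fin n → ℤ)}
    (h : of w * syllableProd φ l = syllableProd φ l * of w')
    {l' : List (ℤˣ × Multiplicative (Fin n → ℤ))} (hl' : l' <+: l) {j : ℤ}
    (hj : min 0 (l'.map fun x => (x.1 : ℤ)).sum < j)
    (hj' : j ≤ max 0 (l'.map fun x => (x.1 : ℤ)).sum) :
    MemZpowImage A L j (toAdd w) := by
  induction l generalizing w l' j with
  | nil =>
    obtain rfl := List.prefix_nil.1 hl'
    simp at hj hj'
    omega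
  | cons x l ih =>
    obtain ⟨u, g⟩ := x
    rcases List.prefix_cons_iff.1 hl' with rfl | ⟨l₁, rfl, hl₁⟩
    · simp at hj hj'
      omega
    obtain ⟨a, rfl, ha⟩ := exists_of_mul_syllableProd_cons hl h
    have ih := ih hl.tail ha hl₁ (j := j - u)
    simp only [List.map_cons, List.sum_cons] at hj hj'
    rcases Int.units_eq_one_or u with rfl | rfl
    · by_cases hj1 : j = 1
      · rw [hj1, memZpowImage_one]
        exact (φ a).2
      · rw [← sub_add_cancel j 1]
        refine (memZpowImage_add_one hA (hφ a) _).2 (ih ?_ ?_) <;> simp at hj hj' ⊢ <;> omega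
    · by_cases hj0 : j = 0
      · rw [hj0, memZpowImage_zero]
        exact (φ.symm a).2
      · have key : A.mulVec (ZtoQ n (toAdd (φ.symm a : Multiplicative (Fin n → ℤ)))) =
            ZtoQ n (toAdd (a : Multiplicative (Fin n → ℤ))) :=
          (hφ _).trans (congrArg (fun b : AddSubgroup.toSubgroup (ALsub A L) =>
            ZtoQ n (toAdd (b : Multiplicative (Fin n → ℤ)))) (φ.apply_symm_apply a))
        refine (memZpowImage_add_one hA key _).1 ?_
        convert ih ?_ ?_ using 1 <;> simp at hj hj' ⊢ <;> omega

open Multiplicative in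
/-- The natural homomorphism from `G(A,L)` to the HNN extension of `ℤ^n`. -/
lemma exists_hom_HNNExtension
    {φ : AddSubgroup.toSubgroup L ≃* AddSubgroup.toSubgroup (ALsub A L)} (hφ : ActsByMulVec φ) :
    ∃ f : LM n A L →* HNNExtension (Multiplicative (Fin n → ℤ)) _ _ φ,
      f (Tg n A L) = HNNExtension.t ∧ ∀ v, f (Xv n A L v) = HNNExtension.of (ofAdd v) := by
  let ι : Fin n ⊕ Unit → HNNExtension (Multiplicative (Fin n → ℤ)) _ _ φ :=
    Sum.elim (fun i => HNNExtension.of (ofAdd (Pi.single i 1))) fun _ => HNNExtension.t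
  have hprod (v : Fin n → ℤ) : (List.ofFn fun i => (HNNExtension.of (ofAdd (Pi.single i 1)) :
      HNNExtension (Multiplicative (Fin n → ℤ)) _ _ φ) ^ v i).prod =
      HNNExtension.of (ofAdd v) := by
    have h1 : (fun i => (HNNExtension.of (ofAdd (Pi.single i 1)) :
      HNNExtension (Multiplicative (Fin n → ℤ)) _ _ φ) ^ v i) =
        HNNExtension.of ∘ fun i => ofAdd (Pi.single i (v i)) := by
      funext i
      rw [← map_zpow, ← ofAdd_zsmul, ← Pi.single_smul]
      simp
    rw [h1, ← List.map_ofFn, ← map_list_prod, List.prod_ofFn, ← ofAdd_sum,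
      Finset.univ_sum_single]
  have hword (v : Fin n → ℤ) :
      FreeGroup.lift ι (xWord n v) = HNNExtension.of (ofAdd v) := by
    rw [← hprod, xWord, map_list_prod, List.map_ofFn]
    congr 2
    funext i
    simp [ι]
  have hrel : ∀ r ∈ LMrels n A L, FreeGroup.lift ι r = 1 := by
    rintro r (⟨i, j, rfl⟩ | ⟨v, hv, w, hw, rfl⟩)
    · simp only [map_mul, map_inv, FreeGroup.lift_apply_of, ι, Sum.elim_inl]
      rw [mul_inv_eq_one, mul_inv_eq_iff_eq_mul, ← map_mul, mul_comm, map_mul]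
    · simp only [map_mul, map_inv, FreeGroup.lift_apply_of, ι, Sum.elim_inr, hword]
      have hvw : (φ ⟨ofAdd v, hv⟩ : Multiplicative (Fin n → ℤ)) = ofAdd w :=
        toAdd.injective (ZtoQ_injective n (by rw [← hφ]; exact hw.symm))
      rw [← hvw, HNNExtension.equiv_eq_conj, mul_inv_cancel]
  refine ⟨PresentedGroup.toGroup hrel, PresentedGroup.toGroup.of hrel, fun v => ?_⟩
  rw [← hprod, Xv, map_list_prod, List.map_ofFn]
  congr 2
  funext i
  simp [Xg, ι]

lemma mk_xWord (v : Fin n → ℤ) : PresentedGroup.mk (LMrels n A L) (xWord n v) = Xv n A L v := by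
  rw [xWord, map_list_prod, List.map_ofFn]
  rfl

lemma Tg_mul_Xv {v w : Fin n → ℤ} (hv : v ∈ L) (h : A.mulVec (ZtoQ n v) = ZtoQ n w) :
    Tg n A L * Xv n A L v = Xv n A L w * Tg n A L := by
  have := PresentedGroup.one_of_mem (rels := LMrels n A L) (.inr ⟨v, hv, w, h.symm, rfl⟩)
  rw [map_mul, map_mul, map_mul, map_inv, map_inv, mk_xWord, mk_xWord, mul_inv_eq_one,
    mul_inv_eq_iff_eq_mul] at this
  exact this

lemma commute_Xg (i j : Fin n) : Commute (Xg n A L i) (Xg n A L j) := by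
  have := PresentedGroup.one_of_mem (rels := LMrels n A L) (.inl ⟨i, j, rfl⟩)
  rw [map_mul, map_mul, map_mul, map_inv, map_inv, mul_inv_eq_one, mul_inv_eq_iff_eq_mul] at this
  exact this

lemma commute_Xv (v w : Fin n → ℤ) : Commute (Xv n A L v) (Xv n A L w) := by
  refine Commute.list_prod_left _ _ fun x hx => Commute.list_prod_right _ _ fun y hy => ?_
  obtain ⟨i, rfl⟩ := List.mem_ofFn.1 hx
  obtain ⟨j, rfl⟩ := List.mem_ofFn.1 hy
  exact (commute_Xg i j).zpow_zpow _ _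

lemma exists_Xv_mul_pow (hA : IsUnit A.det) {w : Fin n → ℤ} {m : ℕ}
    (h : ∀ j : ℤ, 0 < j → j ≤ m → MemZpowImage A L j w) :
    ∃ w', (A ^ (m : ℤ)).mulVec (ZtoQ n w') = ZtoQ n w ∧
      Xv n A L w * Tg n A L ^ m = Tg n A L ^ m * Xv n A L w' := by
  induction m with
  | zero => exact ⟨w, by simp⟩
  | succ m ih =>
    obtain ⟨w', hw', hX⟩ := ih fun j hj hj' => h j hj (by push_cast; omega)
    obtain ⟨u, hu, huw⟩ := h (m + 1 : ℕ) (by positivity) le_rfl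
    have huw' : A.mulVec (ZtoQ n u) = ZtoQ n w' := by
      apply mulVec_left_injective (hA.det_zpow (m : ℤ))
      rw [hw', ← huw, Matrix.mulVec_mulVec, ← Matrix.zpow_add_one hA, Nat.cast_succ]
    refine ⟨u, huw, ?_⟩
    rw [pow_succ, ← mul_assoc, hX, mul_assoc, ← Tg_mul_Xv hu huw', mul_assoc]

lemma exists_Xv_mul_inv_pow (hA : IsUnit A.det) (hLA : QImage A L ≤ (ZtoQ n).range)
    {w : Fin n → ℤ} {m : ℕ} (h : ∀ j : ℤ, -(m : ℤ) < j → j ≤ 0 → MemZpowImage A L j w) :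
    ∃ w', (A ^ (-m : ℤ)).mulVec (ZtoQ n w') = ZtoQ n w ∧
      Xv n A L w * (Tg n A L)⁻¹ ^ m = (Tg n A L)⁻¹ ^ m * Xv n A L w' := by
  induction m with
  | zero => exact ⟨w, by simp⟩
  | succ m ih =>
    obtain ⟨w', hw', hX⟩ := ih fun j hj hj' => h j (by push_cast; omega) hj'
    obtain ⟨u, hu, huw⟩ := h (-m : ℤ) (by push_cast; omega) (by omega)
    obtain rfl : u = w' := ZtoQ_injective n
      (mulVec_left_injective (hA.det_zpow (-m : ℤ)) (huw.trans hw'.symm))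
    obtain ⟨w'', hw''⟩ := hLA (mem_QImage.2 ⟨u, hu, rfl⟩)
    have hT := Tg_mul_Xv hu hw''.symm
    refine ⟨w'', ?_, ?_⟩
    · rw [hw'', Matrix.mulVec_mulVec, ← Matrix.zpow_add_one hA, ← hw']
      congr 2
      push_cast
      ring
    · rw [pow_succ, ← mul_assoc, hX, mul_assoc, mul_assoc, mul_right_inj, eq_inv_mul_iff_mul_eq,
        ← mul_assoc, hT, mul_inv_cancel_right]

lemma exists_Xv_mul_zpow (hA : IsUnit A.det) (hLA : QImage A L ≤ (ZtoQ n).range)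
    {w : Fin n → ℤ} {a : ℤ} (h : ∀ j : ℤ, min 0 a < j → j ≤ max 0 a → MemZpowImage A L j w) :
    ∃ w', Xv n A L w * Tg n A L ^ a = Tg n A L ^ a * Xv n A L w' := by
  obtain ⟨m, rfl | rfl⟩ := a.eq_nat_or_neg
  · obtain ⟨w', -, hw'⟩ := exists_Xv_mul_pow hA (w := w) (m := m)
      fun j hj hj' => h j (by omega) (by omega)
    exact ⟨w', by simpa using hw'⟩
  · obtain ⟨w', -, hw'⟩ := exists_Xv_mul_inv_pow hA hLA (w := w) (m := m)
      fun j hj hj' => h j (by omega) (by omega)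
    exact ⟨w', by simpa using hw'⟩

lemma commute_conj_Xv (hA : IsUnit A.det) (hLA : QImage A L ≤ (ZtoQ n).range)
    {v w : Fin n → ℤ} {a : ℤ} (h : ∀ j : ℤ, min 0 a < j → j ≤ max 0 a → MemZpowImage A L j w) :
    Commute (Tg n A L ^ a * Xv n A L v * Tg n A L ^ (-a)) (Xv n A L w) := by
  obtain ⟨w', hw'⟩ := exists_Xv_mul_zpow hA hLA h
  have hw : Xv n A L w = Tg n A L ^ a * Xv n A L w' * (Tg n A L ^ a)⁻¹ :=
    eq_mul_inv_of_mul_eq hw'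
  rw [hw, _root_.zpow_neg, Commute.conj_iff]
  exact commute_Xv v w'

end LearyMinasyan

lemma prod_conj_mul_zpow {G : Type*} [Group G] (t : G) (x : ℕ → G) (α : ℕ → ℤ) {k m : ℕ}
    (hm : m < k) :
    ((List.range (m + 1)).map fun i => t ^ α i * x i * t ^ (-α i)).prod * t ^ α m =
      ((List.range (m + 1)).map fun i => t ^ betaSeq k α i * x i).prod := by
  induction m with
  | zero => simp [betaSeq]
  | succ m ih =>
    rw [List.range_succ, List.map_append, List.prod_append, List.map_append, List.prod_append,
      ← ih (by omega)]
    simp [betaSeq, hm.ne, sub_eq_neg_add, _root_.zpow_add, mul_assoc]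

lemma prod_conj_eq {G : Type*} [Group G] (t : G) (x : ℕ → G) (α : ℕ → ℤ) {k : ℕ} (hk : 0 < k)
    (hx : x k = 1) :
    ((List.range k).map fun i => t ^ α i * x i * t ^ (-α i)).prod =
      ((List.range (k + 1)).map fun i => t ^ betaSeq k α i * x i).prod := by
  obtain ⟨m, rfl⟩ := Nat.exists_eq_add_one_of_ne_zero hk.ne'
  rw [List.range_succ (n := m + 1), List.map_append, List.prod_append,
    ← prod_conj_mul_zpow t x α m.lt_succ_self]
  simp [betaSeq, hx]

lemma sum_betaSeq (α : ℕ → ℤ) {k m : ℕ} (hm : m < k) :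
    ((List.range (m + 1)).map (betaSeq k α)).sum = α m := by
  induction m with
  | zero => simp [betaSeq]
  | succ m ih =>
    rw [List.range_succ, List.map_append, List.sum_append, ih (by omega)]
    simp [betaSeq, hm.ne]

lemma range_succ_eq_append_range' {s m : ℕ} (hs : s ≤ m + 1) :
    List.range (m + 1) = List.range s ++ List.range' s (m + 1 - s) := by
  rw [List.range_eq_range', List.range_eq_range', ← Nat.add_sub_of_le hs, ← List.range'_append]
  simp

open Multiplicative HNNExtension in
lemma memZpowImage_of_commute_prod
    {n : ℕ} {A : Matrix (Fin n) (Fin n) ℚ} (hA : IsUnit A.det)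
    {L : AddSubgroup (Fin n → ℤ)} (hLA : QImage A L ≤ (ZtoQ n).range)
    {k : ℕ} {α : ℕ → ℤ} {v : ℕ → (Fin n → ℤ)}
    (hred1 : ∀ i, 1 ≤ i → i < k → α i ≠ α (i - 1))
    (hred2 : ∀ i < k,
      ¬(0 < betaSeq k α i ∧ betaSeq k α (i + 1) < 0 ∧ v i ∈ L) ∧
      ¬(betaSeq k α i < 0 ∧ 0 < betaSeq k α (i + 1) ∧ v i ∈ ALsub A L))
    {w : Fin n → ℤ}
    (h : Commute ((List.range k).map fun i =>
        Tg n A L ^ (α i) * Xv n A L (v i) * Tg n A L ^ (-(α i))).prod (Xv n A L w))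
    {m : ℕ} (hm : m < k) {j : ℤ} (hj : min 0 (α m) < j) (hj' : j ≤ max 0 (α m)) :
    MemZpowImage A L j w := by
  obtain ⟨φ, hφ⟩ := exists_mulEquiv_toSubgroup hA hLA
  obtain ⟨f, hfT, hfX⟩ := exists_hom_HNNExtension hφ
  let c : ℕ → Multiplicative (Fin n → ℤ) := fun i => if i < k then ofAdd (v i) else 1
  let y : ℕ → ℤ × Multiplicative (Fin n → ℤ) := fun i => (betaSeq k α i, c i)
  -- The first syllable is absorbed in the head of the word when `α 0 = 0`.
  obtain ⟨s, hs1, hs, hhead, hsum⟩ : ∃ s ≤ 1, (∀ i, s ≤ i → i < k → betaSeq k α i ≠ 0) ∧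
      (∃ b : Multiplicative (Fin n → ℤ), ((List.range s).map fun i =>
        (t ^ betaSeq k α i * HNNExtension.of (c i) : HNNExtension _ _ _ φ)).prod =
          HNNExtension.of b) ∧
      ((List.range s).map (betaSeq k α)).sum = 0 := by
    have hne (i : ℕ) (h1 : 1 ≤ i) (hi : i < k) : betaSeq k α i ≠ 0 := by
      have := hred1 i h1 hi
      simp only [betaSeq, hi.ne, if_false]
      omega
    by_cases h0 : α 0 = 0
    · exact ⟨1, le_rfl, hne, ⟨c 0, by simp [betaSeq, h0]⟩, by simp [betaSeq, h0]⟩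
    · refine ⟨0, zero_le_one, fun i _ hi => ?_, ⟨1, by simp⟩, rfl⟩
      rcases Nat.eq_zero_or_pos i with rfl | h1
      · simpa [betaSeq] using h0
      · exact hne i h1 hi
  obtain ⟨b, hb⟩ := hhead
  let p := (List.range' s (k + 1 - s)).map y
  have hp : p.IsChain (ReducedAt (AddSubgroup.toSubgroup L)
      (AddSubgroup.toSubgroup (ALsub A L))) := by
    rw [List.isChain_iff_getElem]
    intro i hi
    simp only [p, List.length_map, List.length_range'] at hi
    simp only [p, List.getElem_map, List.getElem_range', one_mul, y]
    have hik : s + i < k := by omega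
    have h2 := hred2 (s + i) hik
    refine ⟨hs _ (by omega) hik, fun h1 h1' h1'' => h2.1 ⟨h1, h1', ?_⟩,
      fun h1 h1' h1'' => h2.2 ⟨h1, h1', ?_⟩⟩ <;>
    · simpa [c, hik] using h1''
  have hp0 : ∀ x ∈ p, x.1 = 0 → x.2 = 1 := by
    intro x hx hx0
    obtain ⟨i, hi, rfl⟩ := List.mem_map.1 hx
    rw [List.mem_range'_1] at hi
    have : ¬ i < k := fun hik => hs i hi.1 hik hx0
    simp [y, c, this]
  have hfg : f ((List.range k).map fun i =>
      Tg n A L ^ (α i) * Xv n A L (v i) * Tg n A L ^ (-(α i))).prod =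
      HNNExtension.of b * syllableProd φ (syllables p) := by
    rw [syllableProd_syllables φ hp0, List.map_map, ← hb, ← List.prod_append]
    have := prod_conj_eq (t : HNNExtension _ _ _ φ) (fun i => HNNExtension.of (c i)) α
      (by omega : 0 < k) (by simp [c])
    rw [range_succ_eq_append_range' (by omega : s ≤ k + 1), List.map_append] at this
    refine Eq.trans ?_ this
    rw [map_list_prod, List.map_map]
    refine congrArg List.prod (List.map_congr_left fun i hi => ?_)
    simp [hfT, hfX, c, List.mem_range.1 hi]
  have hcomm := (h.map f).eq
  rw [hfg, hfX, mul_assoc, ← mul_assoc (HNNExtension.of _) (HNNExtension.of b), ← map_mul,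
    mul_comm (ofAdd w) b, map_mul, mul_assoc, mul_right_inj] at hcomm
  have hprefix : (List.range' s (m + 1 - s)).map y <+: p := by
    refine List.IsPrefix.map _ ⟨List.range' (s + (m + 1 - s)) (k - m), ?_⟩
    have := List.range'_append (s := s) (m := m + 1 - s) (n := k - m) (step := 1)
    rw [one_mul] at this
    rw [this]
    congr 1
    omega
  have hheight : ((syllables ((List.range' s (m + 1 - s)).map y)).map fun x => (x.1 : ℤ)).sum
      = α m := by
    rw [sum_syllables, ← sum_betaSeq α hm, range_succ_eq_append_range' (by omega : s ≤ m + 1),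
      List.map_append, List.sum_append, hsum, zero_add, List.map_map]
    rfl
  exact memZpowImage_of_isPrefix hA hφ (isChain_syllables hp) hcomm.symm
    (isPrefix_syllables hprefix) (by rwa [hheight]) (by rwa [hheight])

/-- **Corollary (centralisers of `x^w` in `G(A,L)`).** If `g` is represented by a
semi-reduced word `∏_{i=1}^k t^{α_i} x^{v_i} t^{-α_i}`, then `g` commutes with `x^w`
iff `w ∈ ⋂_{j=γ_-+1}^{γ_+} A^j L`. -/
theorem LM_commute_iff_mem_inter
    (n : ℕ) (A : Matrix (Fin n) (Fin n) ℚ) (hA : IsUnit A.det)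
    (L : AddSubgroup (Fin n → ℤ)) (hL : L.FiniteIndex)
    (hLA : QImage A L ≤ (ZtoQ n).range)
    (k : ℕ) (α : ℕ → ℤ) (v : ℕ → (Fin n → ℤ))
    -- the word is semi-reduced:
    (hred1 : ∀ i, 1 ≤ i → i < k → α i ≠ α (i - 1))
    (hred2 : ∀ i < k,
      ¬(0 < betaSeq k α i ∧ betaSeq k α (i + 1) < 0 ∧ v i ∈ L) ∧
      ¬(betaSeq k α i < 0 ∧ 0 < betaSeq k α (i + 1) ∧ v i ∈ ALsub A L))
    (g : LM n A L)
    (hg : g = ((List.range k).map fun i =>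
        Tg n A L ^ (α i) * Xv n A L (v i) * Tg n A L ^ (-(α i))).prod)
    (w : Fin n → ℤ) :
    Commute g (Xv n A L w) ↔
      ∀ j : ℤ,
        (insert (0:ℤ) ((Finset.range k).image α)).min' (Finset.insert_nonempty _ _) + 1 ≤ j →
        j ≤ (insert (0:ℤ) ((Finset.range k).image α)).max' (Finset.insert_nonempty _ _) →
        ∃ u ∈ L, (A ^ j).mulVec (ZtoQ n u) = ZtoQ n w := by
  subst hg
  constructor
  · intro h j hj hj'
    rcases lt_or_ge 0 j with h0 | h0
    · rcases Finset.mem_insert.1 (Finset.max'_mem _ (Finset.insert_nonempty (0 : ℤ)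
        ((Finset.range k).image α))) with hmax | hmax
      · omega
      · obtain ⟨m, hm, hmα⟩ := Finset.mem_image.1 hmax
        exact memZpowImage_of_commute_prod hA hLA hred1 hred2 h (Finset.mem_range.1 hm)
          (by omega) (by omega)
    · rcases Finset.mem_insert.1 (Finset.min'_mem _ (Finset.insert_nonempty (0 : ℤ)
        ((Finset.range k).image α))) with hmin | hmin
      · omega
      · obtain ⟨m, hm, hmα⟩ := Finset.mem_image.1 hmin
        exact memZpowImage_of_commute_prod hA hLA hred1 hred2 h (Finset.mem_range.1 hm)
          (by omega) (by omega)
  · intro h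
    refine Commute.list_prod_left _ _ fun x hx => ?_
    obtain ⟨i, hi, rfl⟩ := List.mem_map.1 hx
    have hmem : α i ∈ insert (0 : ℤ) ((Finset.range k).image α) :=
      Finset.mem_insert_of_mem (Finset.mem_image_of_mem _ (by simpa using hi))
    have hmin := Finset.min'_le _ _ hmem
    have hmax := Finset.le_max' _ _ hmem
    have hmin0 := Finset.min'_le _ _ (Finset.mem_insert_self (0 : ℤ) ((Finset.range k).image α))
    have hmax0 := Finset.le_max' _ _ (Finset.mem_insert_self (0 : ℤ) ((Finset.range k).image α))
    exact commute_conj_Xv hA hLA fun j hj hj' => h j (by omega) (by omega)
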